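/- arXiv:2405.14426 — 5 statements merged into one kernel-verified Lean document; each statement's English description precedes it below -/
import Mathlib

section
/- Consider a hybrid discrete-time system (C, D, f, G) and a function U : C ∪ D ∪ f(C) ∪ G(D) → ℝ≥0 satisfying (P2) and (P3). Then every solution q of (C, D, f, G) satisfies U(q(k,j)) ≤ π(q,k,j) · U(q(0,0)) for all (k,j) ∈ dom q. -/
open Set Filter Matrix

/-- A compact discrete time domain. -/
def CompactDTD (E : Set (ℕ × ℕ)) : Prop :=
  ∃ J : ℕ, 1 ≤ J ∧ ∃ κ : ℕ → ℕ, κ 0 = 0 ∧ (∀ i < J, κ i ≤ κ (i + 1)) ∧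
    E = {p : ℕ × ℕ | p.2 < J ∧ κ p.2 ≤ p.1 ∧ p.1 ≤ κ (p.2 + 1)}

/-- A discrete time domain. -/
def DTD (E : Set (ℕ × ℕ)) : Prop :=
  ∀ p ∈ E, CompactDTD (E ∩ {r : ℕ × ℕ | r.1 ≤ p.1 ∧ r.2 ≤ p.2})

/-- A hybrid discrete-time system. -/
structure HSys (X : Type*) where
  C : Set X
  D : Set X
  f : X → X
  G : X → Set X

/-- A solution of a hybrid discrete-time system. -/
structure Sol {X : Type*} (H : HSys X) where
  dom : Set (ℕ × ℕ)
  q : ℕ × ℕ → X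
  dtd : DTD dom
  flow : ∀ k j : ℕ, (k, j) ∈ dom → (k + 1, j) ∈ dom →
    q (k, j) ∈ H.C ∧ q (k + 1, j) = H.f (q (k, j))
  jump : ∀ k j : ℕ, (k, j) ∈ dom → (k, j + 1) ∈ dom →
    q (k, j) ∈ H.D ∧ q (k, j + 1) ∈ H.G (q (k, j))

def Sol.Maximal {X : Type*} {H : HSys X} (s : Sol H) : Prop :=
  ¬ ∃ s' : Sol H, s.dom ⊂ s'.dom ∧ ∀ p ∈ s.dom, s'.q p = s.q p

def Sol.Complete {X : Type*} {H : HSys X} (s : Sol H) : Prop := s.dom.Infinite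

def Sol.KComplete {X : Type*} {H : HSys X} (s : Sol H) : Prop :=
  ∀ N : ℕ, ∃ k j : ℕ, N ≤ k ∧ (k, j) ∈ s.dom

/-- `k_i`: the physical time at which the `i`-th episode starts. -/
noncomputable def kmin (E : Set (ℕ × ℕ)) (i : ℕ) : ℕ := sInf {k : ℕ | (k, i) ∈ E}

/-- The product `π(q,k,j)`. -/
noncomputable def piProd {X : Type*} (νc νd : X → ℝ) (E : Set (ℕ × ℕ)) (q : ℕ × ℕ → X)
    (k j : ℕ) : ℝ :=
  (∏ j' ∈ Finset.range j,
    ((∏ k' ∈ Finset.Ico (kmin E j') (kmin E (j' + 1)), νc (q (k', j'))) *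
      νd (q (kmin E (j' + 1), j')))) *
  ∏ k'' ∈ Finset.Ico (kmin E j) k, νc (q (k'', j))

/-- Euclidean norm on `Fin n → ℝ`. -/
noncomputable def enorm {n : ℕ} (x : Fin n → ℝ) : ℝ := Real.sqrt (∑ i, (x i) ^ 2)

/-- Class `K∞` functions (on `[0,∞)`). -/
def ClassKInf (α : ℝ → ℝ) : Prop :=
  ContinuousOn α (Set.Ici 0) ∧ StrictMonoOn α (Set.Ici 0) ∧ α 0 = 0 ∧
    Filter.Tendsto α Filter.atTop Filter.atTop

/-- Class `KL` functions (on `[0,∞) × [0,∞)`). -/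
def ClassKL (β : ℝ → ℝ → ℝ) : Prop :=
  (∀ t, 0 ≤ t → ContinuousOn (fun s => β s t) (Set.Ici 0) ∧
      StrictMonoOn (fun s => β s t) (Set.Ici 0) ∧ β 0 t = 0) ∧
  (∀ s, 0 ≤ s → AntitoneOn (fun t => β s t) (Set.Ici 0) ∧
      Filter.Tendsto (fun t => β s t) Filter.atTop (nhds 0))

theorem kmin_le {E : Set (ℕ × ℕ)} {k j : ℕ} (h : (k, j) ∈ E) : kmin E j ≤ k :=
  Nat.sInf_le h

theorem kmin_mem {E : Set (ℕ × ℕ)} {k j : ℕ} (h : (k, j) ∈ E) : (kmin E j, j) ∈ E :=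
  Nat.sInf_mem (s := {k : ℕ | (k, j) ∈ E}) ⟨k, h⟩

/-- Below a point of a discrete time domain, the domain is described by a sequence of jump
times. -/
theorem DTD.exists_jump_times {E : Set (ℕ × ℕ)} (hE : DTD E) {k j : ℕ} (h : (k, j) ∈ E) :
    ∃ J : ℕ, ∃ κ : ℕ → ℕ, κ 0 = 0 ∧ j < J ∧ (∀ i < J, κ i ≤ κ (i + 1)) ∧
      ∀ a b : ℕ, ((a, b) ∈ E ∧ a ≤ k ∧ b ≤ j) ↔ (b < J ∧ κ b ≤ a ∧ a ≤ κ (b + 1)) := by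
  obtain ⟨J, -, κ, h0, hmono, heq⟩ := hE _ h
  have key : ∀ a b : ℕ, ((a, b) ∈ E ∧ a ≤ k ∧ b ≤ j) ↔
      (b < J ∧ κ b ≤ a ∧ a ≤ κ (b + 1)) := fun a b => Set.ext_iff.mp heq (a, b)
  exact ⟨J, κ, h0, ((key k j).mp ⟨h, le_rfl, le_rfl⟩).1, hmono, key⟩

theorem DTD.mem_of_kmin_le {E : Set (ℕ × ℕ)} (hE : DTD E) {k k' j : ℕ} (h : (k, j) ∈ E)
    (h₁ : kmin E j ≤ k') (h₂ : k' ≤ k) : (k', j) ∈ E := by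
  obtain ⟨J, κ, -, hJ, -, key⟩ := hE.exists_jump_times h
  have hmin := (key _ _).mp ⟨kmin_mem h, kmin_le h, le_rfl⟩
  have hk := (key _ _).mp ⟨h, le_rfl, le_rfl⟩
  exact ((key k' j).mpr ⟨hJ, hmin.2.1.trans h₁, h₂.trans hk.2.2⟩).1

theorem DTD.kmin_succ_mem {E : Set (ℕ × ℕ)} (hE : DTD E) {k j : ℕ} (h : (k, j + 1) ∈ E) :
    (kmin E (j + 1), j) ∈ E := by
  obtain ⟨J, κ, -, hJ, hmono, key⟩ := hE.exists_jump_times h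
  have hmin := (key _ _).mp ⟨kmin_mem h, kmin_le h, le_rfl⟩
  have hκ := (key (κ (j + 1)) (j + 1)).mpr ⟨hJ, le_rfl, hmono _ hJ⟩
  have heq : kmin E (j + 1) = κ (j + 1) := le_antisymm (kmin_le hκ.1) hmin.2.1
  rw [heq]
  exact ((key (κ (j + 1)) j).mpr ⟨by omega, hmono j (by omega), le_rfl⟩).1

theorem DTD.kmin_zero {E : Set (ℕ × ℕ)} (hE : DTD E) {k : ℕ} (h : (k, 0) ∈ E) :
    kmin E 0 = 0 := by
  obtain ⟨J, κ, h0, hJ, -, key⟩ := hE.exists_jump_times h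
  exact Nat.le_zero.mp (kmin_le ((key 0 0).mpr ⟨hJ, h0.le, Nat.zero_le _⟩).1)

theorem piProd_flow {X : Type*} (νc νd : X → ℝ) (E : Set (ℕ × ℕ)) (q : ℕ × ℕ → X) {k j : ℕ}
    (h : kmin E j ≤ k) :
    piProd νc νd E q (k + 1) j = νc (q (k, j)) * piProd νc νd E q k j := by
  unfold piProd
  rw [Finset.prod_Ico_succ_top h]
  ring

theorem piProd_jump {X : Type*} (νc νd : X → ℝ) (E : Set (ℕ × ℕ)) (q : ℕ × ℕ → X) (j : ℕ) :
    piProd νc νd E q (kmin E (j + 1)) (j + 1) =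
      νd (q (kmin E (j + 1), j)) * piProd νc νd E q (kmin E (j + 1)) j := by
  unfold piProd
  rw [Finset.prod_range_succ, Finset.Ico_self, Finset.prod_empty]
  ring

/-- Lemma 1: under (P2)-(P3), `U(q(k,j)) ≤ π(q,k,j) · U(q(0,0))`
for every solution and every `(k,j)` in its domain. -/
theorem lyap_bound {n : ℕ} (hn : 1 ≤ n) (H : HSys (Fin n → ℝ))
    (U νc νd : (Fin n → ℝ) → ℝ)
    (hU : ∀ x ∈ H.C ∪ H.D ∪ H.f '' H.C ∪ ⋃ y ∈ H.D, H.G y, 0 ≤ U x)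
    (hP2 : ∀ x ∈ H.C, 0 ≤ νc x ∧ U (H.f x) ≤ νc x * U x)
    (hP3 : ∀ x ∈ H.D, 0 ≤ νd x ∧ ∀ g ∈ H.G x, U g ≤ νd x * U x) :
    ∀ s : Sol H, ∀ k j : ℕ, (k, j) ∈ s.dom →
      U (s.q (k, j)) ≤ piProd νc νd s.dom s.q k j * U (s.q (0, 0)) := by
  intro s
  have flow_bound : ∀ j : ℕ,
      U (s.q (kmin s.dom j, j)) ≤ piProd νc νd s.dom s.q (kmin s.dom j) j * U (s.q (0, 0)) →
      ∀ k, (k, j) ∈ s.dom → U (s.q (k, j)) ≤ piProd νc νd s.dom s.q k j * U (s.q (0, 0)) := by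
    intro j hstart k hk
    induction k, kmin_le hk using Nat.le_induction with
    | base => exact hstart
    | succ k hle ih =>
      have hmem := s.dtd.mem_of_kmin_le hk hle k.le_succ
      obtain ⟨hC, hq⟩ := s.flow k j hmem hk
      obtain ⟨hν, hf⟩ := hP2 _ hC
      rw [hq, piProd_flow νc νd s.dom s.q hle, mul_assoc]
      exact hf.trans (mul_le_mul_of_nonneg_left (ih hmem) hν)
  intro k j
  induction j generalizing k with
  | zero =>
    intro hk
    refine flow_bound 0 ?_ k hk
    simp [s.dtd.kmin_zero hk, piProd]
  | succ j ih =>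
    intro hk
    refine flow_bound (j + 1) ?_ k hk
    have hmem := s.dtd.kmin_succ_mem hk
    obtain ⟨hD, hG⟩ := s.jump _ j hmem (kmin_mem hk)
    obtain ⟨hν, hg⟩ := hP3 _ hD
    rw [piProd_jump, mul_assoc]
    exact (hg _ hG).trans (mul_le_mul_of_nonneg_left (ih _ hmem) hν)
end

section
/- Consider the closed-loop hybrid system H. For every solution q of H and every (k,j) in its domain with k ≥ T, the data consistency relation X(k,j) = 𝒜(κ(k,j))·N(X̂(k,j)) + ℬ(κ(k,j))·N(U(k,j)) holds, where 𝒜(κ) := [A(κ−T), …, A(κ−1)] ∈ ℝ^{n_x×(n_x T)} and ℬ(κ) := [B(κ−T), …, B(κ−1)] ∈ ℝ^{n_x×(n_u T)}, and for Z = [z_1, …, z_T] ∈ ℝ^{n×T}, N(Z) ∈ ℝ^{nT×T} denotes the block-diagonal matrix whose i-th diagonal block is the column z_i. -/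
open Set Filter Matrix

/-- `[M_{2:T}, v]`: delete the first column of `M` and append the column `v`. -/
def shiftAppend {m T : ℕ} (M : Matrix (Fin m) (Fin T) ℝ) (v : Fin m → ℝ) :
    Matrix (Fin m) (Fin T) ℝ :=
  fun i j => if h : (j : ℕ) + 1 < T then M i ⟨(j : ℕ) + 1, h⟩ else v i

/-- The state of the closed-loop hybrid system `H`:
`q = (x, κ, X̂, X, U, K, S, F, a₁, a₂, x̂, τ)`. -/
structure HSt (nx nu T : ℕ) where
  x : Fin nx → ℝ
  κ : ℕ
  Xh : Matrix (Fin nx) (Fin T) ℝ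
  XX : Matrix (Fin nx) (Fin T) ℝ
  UU : Matrix (Fin nu) (Fin T) ℝ
  K : Matrix (Fin nu) (Fin nx) ℝ
  S : Matrix (Fin nx) (Fin nx) ℝ
  F : Matrix (Fin nx) (Fin nx) ℝ
  a1 : ℝ
  a2 : ℝ
  xh : Fin nx → ℝ
  τ : Fin 2

/-- `V(x,S) := xᵀ S x`. -/
def VV {nx : ℕ} (x : Fin nx → ℝ) (S : Matrix (Fin nx) (Fin nx) ℝ) : ℝ :=
  x ⬝ᵥ S.mulVec x

/-- The type of the gain-update map `L`. -/
abbrev LMap (nx nu T : ℕ) :=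
  Matrix (Fin nx) (Fin T) ℝ → Matrix (Fin nx) (Fin T) ℝ → Matrix (Fin nu) (Fin T) ℝ →
    Set (Matrix (Fin nu) (Fin nx) ℝ × Matrix (Fin nx) (Fin nx) ℝ ×
      Matrix (Fin nx) (Fin nx) ℝ × ℝ × ℝ)

/-- The closed-loop hybrid system `H`. -/
def closedLoop {nx nu T : ℕ} (A : ℕ → Matrix (Fin nx) (Fin nx) ℝ)
    (B : ℕ → Matrix (Fin nx) (Fin nu) ℝ) (σ : ℝ → ℝ) (L : LMap nx nu T) :
    HSys (HSt nx nu T) where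
  C := {q | VV q.x q.S ≤ σ q.a1 * VV q.xh q.S ∨ q.τ = 0 ∨ L q.Xh q.XX q.UU = ∅}
  D := {q | σ q.a1 * VV q.xh q.S ≤ VV q.x q.S ∧ q.τ = 1 ∧ (L q.Xh q.XX q.UU).Nonempty}
  f := fun q =>
    { x := (A q.κ + B q.κ * q.K).mulVec q.x
      κ := q.κ + 1
      Xh := shiftAppend q.Xh q.x
      XX := shiftAppend q.XX ((A q.κ + B q.κ * q.K).mulVec q.x)
      UU := shiftAppend q.UU (q.K.mulVec q.x)
      K := q.K, S := q.S, F := q.F, a1 := q.a1, a2 := q.a2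
      xh := q.x, τ := 1 }
  G := fun q =>
    { q' | q'.x = q.x ∧ q'.κ = q.κ ∧ q'.Xh = q.Xh ∧ q'.XX = q.XX ∧ q'.UU = q.UU ∧
        (q'.K, q'.S, q'.F, q'.a1, q'.a2) ∈ L q.Xh q.XX q.UU ∧
        q'.xh = q.xh ∧ q'.τ = 0 }

/-- Solutions of `H` with values in the state space `S_q`
(i.e. `S ∈ S_S`, `F ≻ 0`, `a₁ ∈ [0,1]`, `a₂ ≥ 0`). -/
def Admissible {nx nu T : ℕ} {H : HSys (HSt nx nu T)}
    (SS : Set (Matrix (Fin nx) (Fin nx) ℝ)) (s : Sol H) : Prop :=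
  ∀ p ∈ s.dom, (s.q p).S ∈ SS ∧ (s.q p).F.PosDef ∧
    (s.q p).a1 ∈ Set.Icc (0 : ℝ) 1 ∧ 0 ≤ (s.q p).a2

/-- The horizontal concatenation `[A(κ−T), …, A(κ−1)]`, with column block `i`
equal to `A(κ−T+i)`. -/
def histCat {nx m T : ℕ} (A : ℕ → Matrix (Fin nx) (Fin m) ℝ) (κ : ℕ) :
    Matrix (Fin nx) (Fin T × Fin m) ℝ :=
  fun r c => A (κ - T + (c.1 : ℕ)) r c.2

/-- `N(Z)`: the block-diagonal matrix whose `i`-th diagonal block is the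
`i`-th column of `Z`. -/
def blockN {n T : ℕ} (Z : Matrix (Fin n) (Fin T) ℝ) : Matrix (Fin T × Fin n) (Fin T) ℝ :=
  fun rc j => if rc.1 = j then Z rc.2 j else 0

/-- Every point of a discrete time domain other than the origin has a predecessor in it. -/
lemma DTD.exists_pred {E : Set (ℕ × ℕ)} (hE : DTD E) {k j : ℕ} (h : (k, j) ∈ E) :
    (k = 0 ∧ j = 0) ∨ (∃ k', k = k' + 1 ∧ (k', j) ∈ E) ∨ ∃ j', j = j' + 1 ∧ (k, j') ∈ E := by
  obtain ⟨J, -, t, ht0, ht, heq⟩ := hE _ h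
  have hmem : ∀ p : ℕ × ℕ, p.2 < J → t p.2 ≤ p.1 → p.1 ≤ t (p.2 + 1) → p ∈ E := by
    intro p h1 h2 h3
    have hp : p ∈ E ∩ {r : ℕ × ℕ | r.1 ≤ k ∧ r.2 ≤ j} := heq ▸ ⟨h1, h2, h3⟩
    exact hp.1
  have hkj : (k, j) ∈ E ∩ {r : ℕ × ℕ | r.1 ≤ k ∧ r.2 ≤ j} := ⟨h, le_rfl, le_rfl⟩
  rw [heq] at hkj
  obtain ⟨h1, h2, h3⟩ : j < J ∧ t j ≤ k ∧ k ≤ t (j + 1) := hkj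
  rcases h2.lt_or_eq with hlt | hk
  · obtain ⟨k', rfl⟩ : ∃ k', k = k' + 1 := ⟨k - 1, by omega⟩
    exact .inr (.inl ⟨k', rfl, hmem (k', j) h1 (Nat.lt_succ_iff.mp hlt) (by grind)⟩)
  · cases j with
    | zero => exact .inl ⟨hk ▸ ht0, rfl⟩
    | succ j' =>
      exact .inr (.inr ⟨j', rfl, hmem (k, j') (by grind) (hk ▸ ht j' (by omega)) hk.ge⟩)

/-- Induction along a solution of a hybrid system. -/
lemma Sol.induction {X : Type*} {H : HSys X} (s : Sol H) (P : ℕ → X → Prop)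
    (zero : P 0 (s.q (0, 0)))
    (flow : ∀ k x, x ∈ H.C → P k x → P (k + 1) (H.f x))
    (jump : ∀ k x y, x ∈ H.D → y ∈ H.G x → P k x → P k y)
    (k j : ℕ) (h : (k, j) ∈ s.dom) : P k (s.q (k, j)) := by
  induction hn : k + j generalizing k j with
  | zero =>
    obtain ⟨rfl, rfl⟩ : k = 0 ∧ j = 0 := by omega
    exact zero
  | succ n ih =>
    rcases s.dtd.exists_pred h with ⟨rfl, rfl⟩ | ⟨k', rfl, h'⟩ | ⟨j', rfl, h'⟩
    · exact zero
    · obtain ⟨hC, hf⟩ := s.flow k' j h' h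
      exact hf ▸ flow k' _ hC (ih k' j h' (by omega))
    · obtain ⟨hD, hG⟩ := s.jump k j' h' h
      exact jump k _ _ hD hG (ih k j' h' (by omega))

/-- The columns of the data matrices that were recorded during the last `k` time steps are
consistent with the dynamics. -/
def HSt.ConsistentSince {nx nu T : ℕ} (A : ℕ → Matrix (Fin nx) (Fin nx) ℝ)
    (B : ℕ → Matrix (Fin nx) (Fin nu) ℝ) (k : ℕ) (q : HSt nx nu T) : Prop :=
  k ≤ q.κ ∧ ∀ (c : Fin T) (m : ℕ), T ≤ k + c → m + T = q.κ + c →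
    q.XX.col c = A m *ᵥ q.Xh.col c + B m *ᵥ q.UU.col c

lemma shiftAppend_col_of_lt {m T : ℕ} (M : Matrix (Fin m) (Fin T) ℝ) (v : Fin m → ℝ)
    {c : Fin T} (h : (c : ℕ) + 1 < T) : (shiftAppend M v).col c = M.col ⟨c + 1, h⟩ := by
  ext i
  simp [shiftAppend, Matrix.col, h]

lemma shiftAppend_col_of_not_lt {m T : ℕ} (M : Matrix (Fin m) (Fin T) ℝ) (v : Fin m → ℝ)
    {c : Fin T} (h : ¬ (c : ℕ) + 1 < T) : (shiftAppend M v).col c = v := by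
  ext i
  simp [shiftAppend, Matrix.col, h]

lemma HSt.ConsistentSince.flow {nx nu T : ℕ} {A : ℕ → Matrix (Fin nx) (Fin nx) ℝ}
    {B : ℕ → Matrix (Fin nx) (Fin nu) ℝ} (σ : ℝ → ℝ) (L : LMap nx nu T) {k : ℕ}
    {q : HSt nx nu T} (h : q.ConsistentSince A B k) :
    ((closedLoop A B σ L).f q).ConsistentSince A B (k + 1) := by
  refine ⟨Nat.succ_le_succ h.1, fun c m hc hm => ?_⟩
  simp only [closedLoop] at hm ⊢
  by_cases hlt : (c : ℕ) + 1 < T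
  · simp only [shiftAppend_col_of_lt _ _ hlt]
    exact h.2 ⟨c + 1, hlt⟩ m (by grind) (by grind)
  · obtain rfl : m = q.κ := by omega
    simp only [shiftAppend_col_of_not_lt _ _ hlt, Matrix.add_mulVec, Matrix.mulVec_mulVec]

lemma histCat_mul_blockN_apply {nx m T : ℕ} (A : ℕ → Matrix (Fin nx) (Fin m) ℝ) (κ : ℕ)
    (Z : Matrix (Fin m) (Fin T) ℝ) (i : Fin nx) (c : Fin T) :
    (histCat A κ * blockN Z : Matrix (Fin nx) (Fin T) ℝ) i c = (A (κ - T + c) *ᵥ Z.col c) i := by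
  refine (Matrix.mul_apply (M := histCat A κ) (N := blockN Z)).trans ?_
  simp [Matrix.mulVec, dotProduct, histCat, blockN, Fintype.sum_prod_type_right]

/-- Lemma 3: along any solution of the closed-loop hybrid system `H`,
for `k ≥ T` the data satisfy `X = 𝒜(κ)N(X̂) + ℬ(κ)N(U)`. -/
theorem data_consistency {nx nu T : ℕ} (hnx : 1 ≤ nx) (hnu : 1 ≤ nu) (hT : 1 ≤ T)
    (A : ℕ → Matrix (Fin nx) (Fin nx) ℝ) (B : ℕ → Matrix (Fin nx) (Fin nu) ℝ)
    (SS : Set (Matrix (Fin nx) (Fin nx) ℝ))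
    (hSSpd : ∀ S ∈ SS, S.PosDef)
    (hSSbd : ∃ c : ℝ, ∀ S ∈ SS, ∀ i j, |S i j| ≤ c)
    (σ : ℝ → ℝ) (hσ : ∀ r ∈ Set.Icc (0 : ℝ) 1, σ r ∈ Set.Icc (0 : ℝ) 1)
    (L : LMap nx nu T)
    (hL : ∀ Xh XX UU K S F a1 a2, (K, S, F, a1, a2) ∈ L Xh XX UU →
      S ∈ SS ∧ F.PosDef ∧ a1 ∈ Set.Icc (0 : ℝ) 1 ∧ 0 ≤ a2)
    (s : Sol (closedLoop A B σ L)) (hadm : Admissible SS s)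
    (k j : ℕ) (hkj : (k, j) ∈ s.dom) (hk : T ≤ k) :
    (s.q (k, j)).XX =
      histCat A ((s.q (k, j)).κ) * blockN ((s.q (k, j)).Xh) +
        histCat B ((s.q (k, j)).κ) * blockN ((s.q (k, j)).UU) := by
  have hcons : (s.q (k, j)).ConsistentSince A B k := by
    refine s.induction (fun k q => q.ConsistentSince A B k) ⟨Nat.zero_le _, fun c m hc => ?_⟩
      (fun k q _ h => h.flow σ L) (fun k q q' _ hG h => ?_) k j hkj
    · exact absurd hc (by simp)
    · obtain ⟨-, hκ, hXh, hXX, hUU, -⟩ := hG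
      simpa only [HSt.ConsistentSince, hκ, hXh, hXX, hUU] using h
  ext i c
  have hκ := hcons.1
  rw [Matrix.add_apply, histCat_mul_blockN_apply, histCat_mul_blockN_apply]
  exact congrFun (hcons.2 c ((s.q (k, j)).κ - T + c) (by omega) (by omega)) i
end

section
/- Let n_x, n_u, T ≥ 1 be integers, X̂, X ∈ ℝ^{n_x×T}, U ∈ ℝ^{n_u×T}, Z := [X̂; U] ∈ ℝ^{(n_x+n_u)×T} (stacking X̂ above U), M := ZZᵀ, and let F be a symmetric positive definite n_x×n_x matrix. Assume M is invertible. Then the set Ê(F) := {W ∈ ℝ^{(n_x+n_u)×n_x} : (WᵀZ − X)(WᵀZ − X)ᵀ ⪯ F} is nonempty if and only if Δ := XZᵀM⁻¹ZXᵀ − XXᵀ + F is positive semidefinite. -/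
open Matrix

/-- Completing the square for the least-squares residual `WᵀZ - X` around the minimizer
`(ZZᵀ)⁻¹ZXᵀ`. -/
lemma residual_mul_transpose_eq {m n p R : Type*} [Fintype m] [DecidableEq m] [Fintype n]
    [CommRing R] (Z : Matrix m n R) (hZ : IsUnit (Z * Zᵀ))
    (X : Matrix p n R) (W : Matrix m p R) :
    (Wᵀ * Z - X) * (Wᵀ * Z - X)ᵀ =
      ((W - (Z * Zᵀ)⁻¹ * Z * Xᵀ)ᵀ * Z) * ((W - (Z * Zᵀ)⁻¹ * Z * Xᵀ)ᵀ * Z)ᵀ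
        + (X * Xᵀ - X * Zᵀ * (Z * Zᵀ)⁻¹ * Z * Xᵀ) := by
  have hdet : IsUnit (Z * Zᵀ).det := (Matrix.isUnit_iff_isUnit_det _).mp hZ
  have hsymm : ((Z * Zᵀ)⁻¹)ᵀ = (Z * Zᵀ)⁻¹ := by
    rw [Matrix.transpose_nonsing_inv, Matrix.transpose_mul, Matrix.transpose_transpose]
  set V := (Z * Zᵀ)⁻¹ * Z * Xᵀ with hV
  have hVt : Vᵀ = X * Zᵀ * (Z * Zᵀ)⁻¹ := by
    rw [hV, Matrix.transpose_mul, Matrix.transpose_mul, hsymm, Matrix.transpose_transpose,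
      Matrix.mul_assoc]
  have hright : Z * (Zᵀ * V) = Z * Xᵀ := by
    rw [← Matrix.mul_assoc, hV, Matrix.mul_assoc _ Z, Matrix.mul_nonsing_inv_cancel_left _ _ hdet]
  have hleft : Vᵀ * (Z * Zᵀ) = X * Zᵀ := by
    rw [hVt, Matrix.nonsing_inv_mul_cancel_right _ _ hdet]
  rw [← hVt]
  simp only [Matrix.transpose_sub, Matrix.transpose_mul, Matrix.transpose_transpose,
    Matrix.sub_mul, Matrix.mul_sub, Matrix.mul_assoc, hright]
  have hcross : Vᵀ * (Z * (Zᵀ * W)) = X * (Zᵀ * W) := by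
    rw [← Matrix.mul_assoc Z, ← Matrix.mul_assoc, hleft, Matrix.mul_assoc]
  rw [hcross]
  abel

/-- Lemma 4(i): with `Z = [X̂; U]`, `M = ZZᵀ` invertible and `F ≻ 0`,
the matrix proximity set `Ê(F) = {W : (WᵀZ − X)(WᵀZ − X)ᵀ ⪯ F}` is nonempty iff
`Δ = XZᵀM⁻¹ZXᵀ − XXᵀ + F ⪰ 0`. -/
theorem proximity_set_nonempty_iff {nx nu T : ℕ} (hnx : 1 ≤ nx) (hnu : 1 ≤ nu)
    (hT : 1 ≤ T)
    (Xh X : Matrix (Fin nx) (Fin T) ℝ) (U : Matrix (Fin nu) (Fin T) ℝ)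
    (F : Matrix (Fin nx) (Fin nx) ℝ) (hF : F.PosDef)
    (Z : Matrix (Fin nx ⊕ Fin nu) (Fin T) ℝ) (hZ : Z = Matrix.fromRows Xh U)
    (M : Matrix (Fin nx ⊕ Fin nu) (Fin nx ⊕ Fin nu) ℝ) (hM : M = Z * Zᵀ)
    (hMinv : IsUnit M) :
    (∃ W : Matrix (Fin nx ⊕ Fin nu) (Fin nx) ℝ,
        (F - (Wᵀ * Z - X) * (Wᵀ * Z - X)ᵀ).PosSemidef) ↔
      (X * Zᵀ * M⁻¹ * Z * Xᵀ - X * Xᵀ + F).PosSemidef := by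
  subst hM
  constructor
  · rintro ⟨W, hW⟩
    have hsq := Matrix.posSemidef_self_mul_conjTranspose
      ((W - (Z * Zᵀ)⁻¹ * Z * Xᵀ)ᵀ * Z)
    rw [Matrix.conjTranspose_eq_transpose_of_trivial] at hsq
    rw [residual_mul_transpose_eq Z hMinv] at hW
    convert hW.add hsq using 1
    abel
  · intro h
    refine ⟨(Z * Zᵀ)⁻¹ * Z * Xᵀ, ?_⟩
    rw [residual_mul_transpose_eq Z hMinv, sub_self, Matrix.transpose_zero, Matrix.zero_mul,
      Matrix.zero_mul, zero_add]
    convert h using 1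
    abel
end

section
/- Let n_x, n_u, T ≥ 1 be integers, X̂, X ∈ ℝ^{n_x×T}, U ∈ ℝ^{n_u×T}, Z := [X̂; U] ∈ ℝ^{(n_x+n_u)×T}, M := ZZᵀ, and let F be a symmetric positive definite n_x×n_x matrix. Assume M is invertible, and set Z_c := M⁻¹ZXᵀ and Δ := XZᵀM⁻¹ZXᵀ − XXᵀ + F. Then for every W ∈ ℝ^{(n_x+n_u)×n_x}: (WᵀZ − X)(WᵀZ − X)ᵀ ⪯ F if and only if (W − Z_c)ᵀ M (W − Z_c) ⪯ Δ. In other words, the matrix proximity set Ê(F) is the (matrix) ellipsoid with center Z_c, shape matrix M and radius matrix Δ. -/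
open Matrix

/-- Completing the square for the Gram matrix of the residual `Wᵀ * Z - X`. -/
theorem residual_gram_eq_complete_square {m n t R : Type*} [Fintype m] [DecidableEq m] [Fintype t]
    [CommRing R] (Z : Matrix m t R) (X : Matrix n t R) (W : Matrix m n R)
    (h : IsUnit (Z * Zᵀ)) :
    (Wᵀ * Z - X) * (Wᵀ * Z - X)ᵀ =
      (W - (Z * Zᵀ)⁻¹ * Z * Xᵀ)ᵀ * (Z * Zᵀ) * (W - (Z * Zᵀ)⁻¹ * Z * Xᵀ)
        - X * Zᵀ * (Z * Zᵀ)⁻¹ * Z * Xᵀ + X * Xᵀ := by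
  have hdet : IsUnit (Z * Zᵀ).det := (isUnit_iff_isUnit_det _).mp h
  have hMC : Z * Zᵀ * ((Z * Zᵀ)⁻¹ * Z * Xᵀ) = Z * Xᵀ := by
    rw [Matrix.mul_assoc (Z * Zᵀ)⁻¹, mul_nonsing_inv_cancel_left _ _ hdet]
  have hCT : ((Z * Zᵀ)⁻¹ * Z * Xᵀ)ᵀ = X * Zᵀ * (Z * Zᵀ)⁻¹ := by
    simp [transpose_mul, transpose_nonsing_inv, Matrix.mul_assoc]
  have hCM : X * Zᵀ * (Z * Zᵀ)⁻¹ * (Z * Zᵀ) = X * Zᵀ :=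
    nonsing_inv_mul_cancel_right _ _ hdet
  rw [Matrix.mul_assoc, Matrix.mul_sub (Z * Zᵀ), hMC, transpose_sub W, hCT, Matrix.sub_mul Wᵀ,
    Matrix.mul_sub (X * Zᵀ * (Z * Zᵀ)⁻¹), ← Matrix.mul_assoc _ (Z * Zᵀ) W, hCM]
  simp only [transpose_sub, transpose_mul, transpose_transpose, Matrix.sub_mul, Matrix.mul_sub,
    Matrix.mul_assoc]
  abel

/-- Lemma 4(ii): with `Z = [X̂; U]`, `M = ZZᵀ` invertible, `F ≻ 0`,
`Z_c = M⁻¹ZXᵀ` and `Δ = XZᵀM⁻¹ZXᵀ − XXᵀ + F`, for every `W`: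
`(WᵀZ − X)(WᵀZ − X)ᵀ ⪯ F` iff `(W − Z_c)ᵀM(W − Z_c) ⪯ Δ`. -/
theorem proximity_set_ellipsoid {nx nu T : ℕ} (hnx : 1 ≤ nx) (hnu : 1 ≤ nu)
    (hT : 1 ≤ T)
    (Xh X : Matrix (Fin nx) (Fin T) ℝ) (U : Matrix (Fin nu) (Fin T) ℝ)
    (F : Matrix (Fin nx) (Fin nx) ℝ) (hF : F.PosDef)
    (Z : Matrix (Fin nx ⊕ Fin nu) (Fin T) ℝ) (hZ : Z = Matrix.fromRows Xh U)
    (M : Matrix (Fin nx ⊕ Fin nu) (Fin nx ⊕ Fin nu) ℝ) (hM : M = Z * Zᵀ)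
    (hMinv : IsUnit M)
    (Zc : Matrix (Fin nx ⊕ Fin nu) (Fin nx) ℝ) (hZc : Zc = M⁻¹ * Z * Xᵀ)
    (Δ : Matrix (Fin nx) (Fin nx) ℝ) (hΔ : Δ = X * Zᵀ * M⁻¹ * Z * Xᵀ - X * Xᵀ + F) :
    ∀ W : Matrix (Fin nx ⊕ Fin nu) (Fin nx) ℝ,
      (F - (Wᵀ * Z - X) * (Wᵀ * Z - X)ᵀ).PosSemidef ↔
        (Δ - (W - Zc)ᵀ * M * (W - Zc)).PosSemidef := by
  intro W
  subst hΔ hZc hM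
  rw [residual_gram_eq_complete_square Z X W hMinv]
  apply iff_of_eq
  congr 1
  abel
end

section
/- Let n_x, n_u, T ≥ 1 be integers, X̂, X ∈ ℝ^{n_x×T}, U ∈ ℝ^{n_u×T}, Z := [X̂; U] ∈ ℝ^{(n_x+n_u)×T}, M := ZZᵀ, and let F be a symmetric positive definite n_x×n_x matrix. Assume the set Ê(F) := {W ∈ ℝ^{(n_x+n_u)×n_x} : (WᵀZ − X)(WᵀZ − X)ᵀ ⪯ F} is nonempty. Then Ê(F) is a bounded subset of ℝ^{(n_x+n_u)×n_x} if and only if M is positive definite (equivalently, Z has full row rank). -/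
open Matrix

/-- If `v` is a left null vector of `Z`, adding a rank-one multiple of `v` to `W` does not change
`Wᵀ * Z`. -/
theorem transpose_add_vecMulVec_mul {n m p : Type*} [Fintype n]
    {Z : Matrix n p ℝ} {v : n → ℝ} (hv : v ᵥ* Z = 0) (W : Matrix n m ℝ) (w : m → ℝ) :
    (W + vecMulVec v w)ᵀ * Z = Wᵀ * Z := by
  rw [transpose_add, Matrix.add_mul, transpose_vecMulVec, vecMulVec_mul, hv]
  ext i j
  simp [vecMulVec_apply]

/-- A Gram matrix `Z * Zᵀ` is positive definite once `Z` has no nonzero left null vector. -/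
theorem posDef_mul_transpose_of_vecMul_ne_zero {n p : Type*} [Fintype n] [Fintype p]
    {Z : Matrix n p ℝ} (h : ∀ v, v ≠ 0 → v ᵥ* Z ≠ 0) : (Z * Zᵀ).PosDef := by
  have hinj : Function.Injective Z.vecMul := fun a b hab => by
    by_contra hne
    exact h (a - b) (sub_ne_zero.2 hne) (by rw [sub_vecMul]; exact sub_eq_zero.2 hab)
  simpa using PosDef.mul_conjTranspose_self Z hinj

/-- The squared entries of `E` are bounded by the diagonal of `F` when `E * Eᵀ ⪯ F`. -/
theorem sq_apply_le_of_posSemidef_sub {m p : Type*} [Fintype p]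
    {F : Matrix m m ℝ} {E : Matrix m p ℝ} (h : (F - E * Eᵀ).PosSemidef) (j : m) (k : p) :
    E j k ^ 2 ≤ F j j := by
  have hd := h.diag_nonneg (i := j)
  rw [Matrix.sub_apply, mul_apply] at hd
  have hk := Finset.single_le_sum (f := fun k => E j k * Eᵀ k j)
    (fun k _ => mul_self_nonneg (E j k)) (Finset.mem_univ k)
  simp only [transpose_apply] at hd hk
  nlinarith

/-- A matrix proximity set is entrywise bounded when `Z * Zᵀ` is positive definite. -/
theorem exists_abs_apply_le_of_posDef {n m p : Type*} [Fintype n] [DecidableEq n] [Fintype m]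
    [Fintype p] {Z : Matrix n p ℝ} (hZ : (Z * Zᵀ).PosDef) (X : Matrix m p ℝ) (F : Matrix m m ℝ) :
    ∃ c : ℝ, ∀ W : Matrix n m ℝ,
      (F - (Wᵀ * Z - X) * (Wᵀ * Z - X)ᵀ).PosSemidef → ∀ i j, |W i j| ≤ c := by
  set L := (Z * Zᵀ)⁻¹ * Z with hL
  let b : n → m → ℝ := fun i j => ∑ k, |L i k| * (|F j j| + 1 + |X j k|)
  have hb : ∀ i j, 0 ≤ b i j := fun i j => Finset.sum_nonneg fun k _ => by positivity
  refine ⟨∑ i, ∑ j, b i j, fun W hW i j => ?_⟩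
  have hWL : W = L * (Wᵀ * Z)ᵀ := by
    rw [transpose_mul, transpose_transpose, hL, Matrix.mul_assoc, ← Matrix.mul_assoc Z,
      nonsing_inv_mul_cancel_left _ _ ((isUnit_iff_isUnit_det _).1 hZ.isUnit)]
  calc |W i j| = |∑ k, L i k * (Wᵀ * Z) j k| := by
        conv_lhs => rw [hWL, mul_apply]
        rfl
    _ ≤ ∑ k, |L i k * (Wᵀ * Z) j k| := Finset.abs_sum_le_sum_abs _ _
    _ ≤ b i j := Finset.sum_le_sum fun k _ => by
        rw [abs_mul]
        gcongr
        have hE := (sq_apply_le_of_posSemidef_sub hW j k).trans (le_abs_self _)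
        rw [Matrix.sub_apply] at hE
        have habs := abs_sub_abs_le_abs_sub ((Wᵀ * Z) j k) (X j k)
        nlinarith [sq_abs ((Wᵀ * Z) j k - X j k), sq_nonneg (|(Wᵀ * Z) j k - X j k| - 1),
          sq_nonneg (|(Wᵀ * Z) j k - X j k|)]
    _ ≤ ∑ j, b i j :=
        Finset.single_le_sum (f := b i) (fun j _ => hb i j) (Finset.mem_univ j)
    _ ≤ ∑ i, ∑ j, b i j :=
        Finset.single_le_sum (f := fun i => ∑ j, b i j)
          (fun i _ => Finset.sum_nonneg fun j _ => hb i j) (Finset.mem_univ i)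

/-- Lemma 4(iii): with `Z = [X̂; U]`, `M = ZZᵀ` and `F ≻ 0`, if the
matrix proximity set `Ê(F) = {W : (WᵀZ − X)(WᵀZ − X)ᵀ ⪯ F}` is nonempty, then it is
bounded iff `M ≻ 0`. -/
theorem proximity_set_bounded_iff {nx nu T : ℕ} (hnx : 1 ≤ nx) (hnu : 1 ≤ nu)
    (hT : 1 ≤ T)
    (Xh X : Matrix (Fin nx) (Fin T) ℝ) (U : Matrix (Fin nu) (Fin T) ℝ)
    (F : Matrix (Fin nx) (Fin nx) ℝ) (hF : F.PosDef)
    (Z : Matrix (Fin nx ⊕ Fin nu) (Fin T) ℝ) (hZ : Z = Matrix.fromRows Xh U)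
    (M : Matrix (Fin nx ⊕ Fin nu) (Fin nx ⊕ Fin nu) ℝ) (hM : M = Z * Zᵀ)
    (hne : ∃ W : Matrix (Fin nx ⊕ Fin nu) (Fin nx) ℝ,
      (F - (Wᵀ * Z - X) * (Wᵀ * Z - X)ᵀ).PosSemidef) :
    (∃ c : ℝ, ∀ W : Matrix (Fin nx ⊕ Fin nu) (Fin nx) ℝ,
        (F - (Wᵀ * Z - X) * (Wᵀ * Z - X)ᵀ).PosSemidef → ∀ i j, |W i j| ≤ c) ↔
      M.PosDef := by
  subst hM
  refine ⟨?_, fun hM => exists_abs_apply_le_of_posDef hM X F⟩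
  rintro ⟨c, hc⟩
  obtain ⟨W, hW⟩ := hne
  refine posDef_mul_transpose_of_vecMul_ne_zero fun v hv hvZ => ?_
  obtain ⟨i, hi⟩ := Function.ne_iff.1 hv
  have hvi : v i ≠ 0 := hi
  let j : Fin nx := ⟨0, hnx⟩
  have h := hc (W + vecMulVec v fun _ => (c + 1 - W i j) / v i)
    (by rwa [transpose_add_vecMulVec_mul hvZ]) i j
  rw [Matrix.add_apply, vecMulVec_apply, mul_div_cancel₀ _ hvi, add_sub_cancel] at h
  linarith [le_abs_self (c + 1)]
end
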